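/- Let k be an infinite field, R = k[s,t], and let I ⊂ R be a height-2 ideal minimally generated by three forms f_1, f_2, f_3 of degree 5 whose Hilbert–Burch matrix has columns of degrees 2 and 3, with first column (s^2, st, t^2)^t, and let A, B, C, D be the k-linear forms in x, y, z determined by the second column, chosen generically. Then the form F = −x^3D^2 + x^2yCD − xy^2BD + x^2z(2BD − C^2) + xz^2(2AC − B^2) + xyz(BC − 3AD) − y^2zAC + yz^2AB + y^3AD − z^3A^2 is a nonzero form of degree 5 generating the kernel of the k-algebra map k[x,y,z] → k[f_1,f_2,f_3]; in particular, the rational map Ψ: P^1 ⇢ P^2 defined by f_1, f_2, f_3 is birational onto its image, a plane curve of degree 5. -/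

import Mathlib

open MvPolynomial

/-- The height of an ideal: the infimum of the heights of the prime ideals containing it. -/
noncomputable def Ideal.heightOf {R : Type*} [CommRing R] (I : Ideal R) : ℕ∞ :=
  ⨅ (P : PrimeSpectrum R) (_ : I ≤ P.asIdeal), Order.height P

namespace MvPolynomial

section Homogeneous

variable {σ R S : Type*} [CommRing R]

/-- Evaluating a homogeneous form at a rescaled point. -/
theorem aeval_mul_of_isHomogeneous [CommRing S] [Algebra R S] {p : MvPolynomial σ R} {n : ℕ}
    (hp : p.IsHomogeneous n) (r : S) (v : σ → S) :
    aeval (fun i => r * v i) p = r ^ n * aeval v p := by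
  rw [aeval_def, aeval_def, eval₂_eq, eval₂_eq, Finset.mul_sum]
  refine Finset.sum_congr rfl fun d hd => ?_
  have hdeg : ∑ i ∈ d.support, d i = n := by
    rw [hp.degree_eq_sum_deg_support hd]
  simp only [mul_pow, Finset.prod_mul_distrib, Finset.prod_pow_eq_pow_sum, hdeg]
  ring

/-- The substitution `X i ↦ X i * T` records the homogeneous components as coefficients. -/
theorem coeff_aeval_C_X_mul_X (p : MvPolynomial σ R) (n : ℕ) :
    (aeval (fun i => Polynomial.C (X i : MvPolynomial σ R) * Polynomial.X) p).coeff n =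
      homogeneousComponent n p := by
  conv_lhs => rw [← sum_homogeneousComponent p]
  have key : ∀ i, aeval (fun i => Polynomial.C (X i : MvPolynomial σ R) * Polynomial.X)
      (homogeneousComponent i p) =
        Polynomial.X ^ i * Polynomial.C (homogeneousComponent i p) := by
    intro i
    simp_rw [mul_comm (Polynomial.C _) Polynomial.X]
    rw [aeval_mul_of_isHomogeneous (homogeneousComponent_isHomogeneous i p)]
    congr 1
    have h : (aeval fun j => Polynomial.C (X j : MvPolynomial σ R)) =
        (IsScalarTower.toAlgHom R (MvPolynomial σ R) (Polynomial (MvPolynomial σ R))) := by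
      ext j
      simp [Polynomial.algebraMap_eq]
    rw [h]
    rfl
  simp only [map_sum, key, Polynomial.finsetSum_coeff, Polynomial.coeff_X_pow_mul',
    Polynomial.coeff_C]
  rcases lt_or_ge p.totalDegree n with h | h
  · rw [homogeneousComponent_eq_zero _ _ h]
    refine Finset.sum_eq_zero fun i hi => ?_
    have : i < n := by have := Finset.mem_range.1 hi; omega
    rw [if_pos this.le, if_neg (by omega)]
  · rw [Finset.sum_eq_single n]
    · simp
    · intro i _ hne
      split_ifs <;> first | rfl | omega
    · intro hn
      exact absurd (Finset.mem_range.2 (by omega)) hn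

/-- Divisors of nonzero homogeneous polynomials are homogeneous. -/
theorem exists_isHomogeneous_of_dvd [IsDomain R] {p q : MvPolynomial σ R} {n : ℕ}
    (hp : p.IsHomogeneous n) (hp0 : p ≠ 0) (hq : q ∣ p) : ∃ d, q.IsHomogeneous d := by
  obtain ⟨r, rfl⟩ := hq
  set θ : MvPolynomial σ R →ₐ[R] Polynomial (MvPolynomial σ R) :=
    aeval (fun i => Polynomial.C (X i : MvPolynomial σ R) * Polynomial.X) with hθ
  have coeff_θ : ∀ (g : MvPolynomial σ R) (m : ℕ), (θ g).coeff m = homogeneousComponent m g :=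
    coeff_aeval_C_X_mul_X
  have hθp : θ (q * r) = Polynomial.monomial n (q * r) := by
    ext1 m
    rw [coeff_θ, homogeneousComponent_of_mem hp, Polynomial.coeff_monomial]
    simp only [eq_comm]
  have hne : θ q * θ r ≠ 0 := by
    rw [← map_mul, hθp]
    simpa using hp0
  have hq0 := left_ne_zero_of_mul hne
  have hr0 := right_ne_zero_of_mul hne
  have h1 := Polynomial.natDegree_mul hq0 hr0
  have h2 := Polynomial.natTrailingDegree_mul hq0 hr0
  rw [← map_mul, hθp, Polynomial.natDegree_monomial_eq n hp0] at h1
  rw [← map_mul, hθp, Polynomial.natTrailingDegree_monomial hp0] at h2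
  have h3 := Polynomial.natTrailingDegree_le_natDegree (θ q)
  have h4 := Polynomial.natTrailingDegree_le_natDegree (θ r)
  refine ⟨(θ q).natDegree, ?_⟩
  have : q = homogeneousComponent (θ q).natDegree q := by
    conv_lhs => rw [← sum_homogeneousComponent q]
    simp_rw [← coeff_θ]
    refine Finset.sum_eq_single _ (fun i _ hi => ?_) (fun hi => ?_)
    · rcases lt_or_gt_of_ne hi with hi | hi
      · exact Polynomial.coeff_eq_zero_of_lt_natTrailingDegree (by omega)
      · exact Polynomial.coeff_eq_zero_of_natDegree_lt hi
    · rw [coeff_θ]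
      exact homogeneousComponent_eq_zero _ _ (by simpa using hi)
  have h := homogeneousComponent_isHomogeneous (θ q).natDegree q
  rwa [← this] at h

/-- The relations among forms of the same positive degree form a homogeneous ideal. -/
theorem aeval_homogeneousComponent_eq_zero {τ : Type*} {f : σ → MvPolynomial τ R} {m : ℕ}
    (hm : m ≠ 0) (hf : ∀ i, (f i).IsHomogeneous m) {p : MvPolynomial σ R}
    (hp : aeval f p = 0) (n : ℕ) : aeval f (homogeneousComponent n p) = 0 := by
  rcases lt_or_ge p.totalDegree n with h | h
  · rw [homogeneousComponent_eq_zero _ _ h, map_zero]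
  have hsum := congrArg (homogeneousComponent (m * n)) hp
  rw [← sum_homogeneousComponent p, map_sum, map_sum, map_zero, Finset.sum_eq_single n] at hsum
  · rwa [homogeneousComponent_eq_self ((homogeneousComponent_isHomogeneous n p).aeval f hf)]
      at hsum
  · intro i _ hi
    rw [homogeneousComponent_of_mem ((homogeneousComponent_isHomogeneous i p).aeval f hf),
      if_neg]
    exact fun h => hi (Nat.eq_of_mul_eq_mul_left (Nat.pos_of_ne_zero hm) h).symm
  · intro hn
    exact absurd (Finset.mem_range.2 (by omega)) hn

end Homogeneous

end MvPolynomial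

/-- If no prime divides both `a` and every `v j`, then `a` divides every `b` such that all
`v j ^ n * b` are multiples of `a`. -/
theorem dvd_of_forall_dvd_pow_mul {M ι : Type*} [CommRing M] [IsDomain M]
    [UniqueFactorizationMonoid M] {a b : M} (ha : a ≠ 0) (v : ι → M) (n : ℕ)
    (h : ∀ j, a ∣ v j ^ n * b) (hv : ∀ q, Prime q → q ∣ a → ∃ j, ¬ q ∣ v j) : a ∣ b := by
  obtain ⟨a', b', c, hrel, rfl, rfl⟩ :=
    UniqueFactorizationMonoid.exists_reduced_factors a ha b
  obtain ⟨hc, ha'⟩ := mul_ne_zero_iff.1 ha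
  have h' : ∀ j, a' ∣ v j ^ n := fun j => by
    refine hrel.dvd_of_dvd_mul_right ((mul_dvd_mul_iff_left hc).1 ?_)
    convert h j using 1
    ring
  by_cases hu : IsUnit a'
  · exact mul_dvd_mul_left c (hu.dvd)
  · obtain ⟨q, hq, hqa⟩ := WfDvdMonoid.exists_irreducible_factor hu ha'
    obtain ⟨j, hj⟩ := hv q hq.prime (hqa.mul_left c)
    exact absurd (hq.prime.dvd_of_dvd_pow (hqa.trans (h' j))) hj

section Quintic

variable {M : Type*} [CommRing M]

/-- Minus the resultant of `x s² + y s t + z t²` and `a s³ + b s² t + c s t² + d t³`. -/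
def elimQuintic (x y z a b c d : M) : M :=
  -(x ^ 3 * d ^ 2) + x ^ 2 * y * c * d - x * y ^ 2 * b * d + x ^ 2 * z * (2 * b * d - c ^ 2) +
    x * z ^ 2 * (2 * a * c - b ^ 2) + x * y * z * (b * c - 3 * a * d) - y ^ 2 * z * a * c +
    y * z ^ 2 * a * b + y ^ 3 * a * d - z ^ 3 * a ^ 2

/-- The coefficient of `s` in the first subresultant of the quadric and the cubic. -/
def subresS (x y z a b c : M) : M := a * (y ^ 2 - x * z) - b * x * y + c * x ^ 2

/-- The coefficient of `t` in the first subresultant of the quadric and the cubic. -/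
def subresT (x y z a b d : M) : M := a * y * z - b * x * z + d * x ^ 2

theorem quadric_subres (x y z a b c d : M) :
    x * (-subresT x y z a b d) ^ 2 + y * (-subresT x y z a b d * subresS x y z a b c) +
      z * subresS x y z a b c ^ 2 = -x ^ 2 * elimQuintic x y z a b c d := by
  simp only [elimQuintic, subresS, subresT]
  ring

theorem cubic_subres (x y z a b c d : M) :
    a * (-subresT x y z a b d) ^ 3 + b * (-subresT x y z a b d) ^ 2 * subresS x y z a b c +
      c * -subresT x y z a b d * subresS x y z a b c ^ 2 + d * subresS x y z a b c ^ 3 =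
    (x * a * subresT x y z a b d - (x * b - y * a) * subresS x y z a b c) *
      elimQuintic x y z a b c d := by
  simp only [elimQuintic, subresS, subresT]
  ring

theorem mul_subresT_sub_mul_subresS (x y z a b c d : M) :
    y * subresT x y z a b d - z * subresS x y z a b c =
      x * (a * z ^ 2 + d * x * y - c * x * z) := by
  simp only [subresS, subresT]
  ring

/-- The quintic lies in the ideal of the quadric and the cubic up to a power of `t`. -/
theorem pow_mul_elimQuintic (x y z a b c d s t : M)
    (hq : x * s ^ 2 + y * (s * t) + z * t ^ 2 = 0)
    (hc : a * s ^ 3 + b * s ^ 2 * t + c * s * t ^ 2 + d * t ^ 3 = 0) :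
    t ^ 4 * elimQuintic x y z a b c d = 0 := by
  rw [show t ^ 4 * elimQuintic x y z a b c d =
    (-a * subresS x y z a b c * s ^ 2 +
      (a * subresT x y z a b d - b * subresS x y z a b c) * (s * t) +
      (b * subresT x y z a b d - c * subresS x y z a b c -
        a * (a * z ^ 2 + d * x * y - c * x * z)) * t ^ 2) *
          (x * s ^ 2 + y * (s * t) + z * t ^ 2) -
    (t * (x * subresT x y z a b d - y * subresS x y z a b c) -
      s * x * subresS x y z a b c) *
        (a * s ^ 3 + b * s ^ 2 * t + c * s * t ^ 2 + d * t ^ 3) by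
      simp only [elimQuintic, subresS, subresT]
      ring, hq, hc]
  ring

end Quintic

section Syzygy

variable {k : Type*} [CommRing k]

/-- The value at `(s, t)` of the `i`-th entry of the cubic column. -/
def cubicAt {M : Type*} [CommRing M] [Algebra k M] (c : Fin 4 × Fin 3 → k) (i : Fin 3)
    (s t : M) : M :=
  algebraMap k M (c (0, i)) * s ^ 3 + algebraMap k M (c (1, i)) * (s ^ 2 * t) +
    algebraMap k M (c (2, i)) * (s * t ^ 2) + algebraMap k M (c (3, i)) * t ^ 3

/-- The values at `(s, t)` of the signed maximal minors of the Hilbert–Burch matrix. -/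
def minorAt {M : Type*} [CommRing M] [Algebra k M] (c : Fin 4 × Fin 3 → k) (s t : M) :
    Fin 3 → M :=
  ![s * t * cubicAt c 2 s t - t ^ 2 * cubicAt c 1 s t,
    t ^ 2 * cubicAt c 0 s t - s ^ 2 * cubicAt c 2 s t,
    s ^ 2 * cubicAt c 1 s t - s * t * cubicAt c 0 s t]

theorem map_minorAt {M N : Type*} [CommRing M] [Algebra k M] [CommRing N] [Algebra k N]
    (e : M →ₐ[k] N) (c : Fin 4 × Fin 3 → k) (s t : M) (j : Fin 3) :
    e (minorAt c s t j) = minorAt c (e s) (e t) j := by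
  fin_cases j <;> simp [minorAt, cubicAt]

theorem isHomogeneous_minorAt (c : Fin 4 × Fin 3 → k) (j : Fin 3) :
    (minorAt c (X 0 : MvPolynomial (Fin 2) k) (X 1) j).IsHomogeneous 5 := by
  have hs := isHomogeneous_X k (0 : Fin 2)
  have ht := isHomogeneous_X k (1 : Fin 2)
  have hc : ∀ i, (cubicAt c i (X 0 : MvPolynomial (Fin 2) k) (X 1)).IsHomogeneous 3 := fun i =>
    ((((hs.pow 3).C_mul _).add (((hs.pow 2).mul ht).C_mul _)).add
      ((hs.mul (ht.pow 2)).C_mul _)).add ((ht.pow 3).C_mul _)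
  fin_cases j
  · exact ((hs.mul ht).mul (hc 2)).sub ((ht.pow 2).mul (hc 1))
  · exact ((ht.pow 2).mul (hc 0)).sub ((hs.pow 2).mul (hc 2))
  · exact ((hs.pow 2).mul (hc 1)).sub ((hs.mul ht).mul (hc 0))

/-- The `m`-th linear form read off from the cubic column. -/
noncomputable def linForm (c : Fin 4 × Fin 3 → k) (m : Fin 4) : MvPolynomial (Fin 3) k :=
  C (c (m, 0)) * X 0 + C (c (m, 1)) * X 1 + C (c (m, 2)) * X 2

/-- The implicit equation. -/
noncomputable def implicitQuintic (c : Fin 4 × Fin 3 → k) : MvPolynomial (Fin 3) k :=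
  elimQuintic (X 0) (X 1) (X 2) (linForm c 0) (linForm c 1) (linForm c 2) (linForm c 3)

/-- The form `S` for which `(-T : S)` inverts the parametrization. -/
noncomputable def inverseS (c : Fin 4 × Fin 3 → k) : MvPolynomial (Fin 3) k :=
  subresS (X 0) (X 1) (X 2) (linForm c 0) (linForm c 1) (linForm c 2)

/-- The form `T` for which `(-T : S)` inverts the parametrization. -/
noncomputable def inverseT (c : Fin 4 × Fin 3 → k) : MvPolynomial (Fin 3) k :=
  subresT (X 0) (X 1) (X 2) (linForm c 0) (linForm c 1) (linForm c 3)

theorem isHomogeneous_linForm (c : Fin 4 × Fin 3 → k) (m : Fin 4) :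
    (linForm c m).IsHomogeneous 1 :=
  (((isHomogeneous_X k _).C_mul _).add ((isHomogeneous_X k _).C_mul _)).add
    ((isHomogeneous_X k _).C_mul _)

theorem isHomogeneous_implicitQuintic (c : Fin 4 × Fin 3 → k) :
    (implicitQuintic c).IsHomogeneous 5 := by
  have hx := isHomogeneous_X k (0 : Fin 3)
  have hy := isHomogeneous_X k (1 : Fin 3)
  have hz := isHomogeneous_X k (2 : Fin 3)
  have ha := isHomogeneous_linForm c 0
  have hb := isHomogeneous_linForm c 1
  have hc := isHomogeneous_linForm c 2
  have hd := isHomogeneous_linForm c 3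
  have h2 : (2 : MvPolynomial (Fin 3) k).IsHomogeneous 0 := isHomogeneous_C (Fin 3) (2 : k)
  have h3 : (3 : MvPolynomial (Fin 3) k).IsHomogeneous 0 := isHomogeneous_C (Fin 3) (3 : k)
  refine IsHomogeneous.sub (.add (.add (.sub (.add (.add (.add (.sub (.add (.neg
    ((hx.pow 3).mul (hd.pow 2))) ((((hx.pow 2).mul hy).mul hc).mul hd))
    (((hx.mul (hy.pow 2)).mul hb).mul hd))
    (((hx.pow 2).mul hz).mul (.sub ((h2.mul hb).mul hd) (hc.pow 2))))
    ((hx.mul (hz.pow 2)).mul (.sub ((h2.mul ha).mul hc) (hb.pow 2))))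
    (((hx.mul hy).mul hz).mul (.sub (hb.mul hc) ((h3.mul ha).mul hd))))
    ((((hy.pow 2).mul hz).mul ha).mul hc)) (((hy.mul (hz.pow 2)).mul ha).mul hb))
    (((hy.pow 3).mul ha).mul hd)) ((hz.pow 3).mul (ha.pow 2))

theorem aeval_linForm {M : Type*} [CommRing M] [Algebra k M] (c : Fin 4 × Fin 3 → k)
    (m : Fin 4) (v : Fin 3 → M) :
    aeval v (linForm c m) = algebraMap k M (c (m, 0)) * v 0 + algebraMap k M (c (m, 1)) * v 1 +
      algebraMap k M (c (m, 2)) * v 2 := by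
  simp [linForm]

theorem aeval_implicitQuintic {M : Type*} [CommRing M] [Algebra k M] (c : Fin 4 × Fin 3 → k)
    (v : Fin 3 → M) :
    aeval v (implicitQuintic c) = elimQuintic (v 0) (v 1) (v 2) (aeval v (linForm c 0))
      (aeval v (linForm c 1)) (aeval v (linForm c 2)) (aeval v (linForm c 3)) := by
  simp [implicitQuintic, elimQuintic]

/-- The implicit equation vanishes on the parametrization. -/
theorem aeval_minorAt_implicitQuintic [IsDomain k] (c : Fin 4 × Fin 3 → k) :
    aeval (minorAt c (X 0 : MvPolynomial (Fin 2) k) (X 1)) (implicitQuintic c) = 0 := by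
  have h : (X 1 : MvPolynomial (Fin 2) k) ^ 4 ≠ 0 := pow_ne_zero _ (X_ne_zero _)
  refine (mul_eq_zero.1 ?_).resolve_left h
  rw [aeval_implicitQuintic]
  apply pow_mul_elimQuintic _ _ _ _ _ _ _ (X 0)
  · simp only [minorAt, Matrix.cons_val]
    ring
  · simp only [aeval_linForm, minorAt, cubicAt, Matrix.cons_val]
    ring

/-- On the curve, the parametrization evaluated at `(-T : S)` is proportional to the
coordinates. -/
theorem implicitQuintic_dvd_cross (c : Fin 4 × Fin 3 → k) (i j : Fin 3) :
    implicitQuintic c ∣ X i * minorAt c (-inverseT c) (inverseS c) j -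
      X j * minorAt c (-inverseT c) (inverseS c) i := by
  have hq := quadric_subres (X 0 : MvPolynomial (Fin 3) k) (X 1) (X 2) (linForm c 0)
    (linForm c 1) (linForm c 2) (linForm c 3)
  have hc := cubic_subres (X 0 : MvPolynomial (Fin 3) k) (X 1) (X 2) (linForm c 0)
    (linForm c 1) (linForm c 2) (linForm c 3)
  change X 0 * (-inverseT c) ^ 2 + X 1 * (-inverseT c * inverseS c) + X 2 * inverseS c ^ 2 =
    -X 0 ^ 2 * implicitQuintic c at hq
  change linForm c 0 * (-inverseT c) ^ 3 + linForm c 1 * (-inverseT c) ^ 2 * inverseS c +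
    linForm c 2 * -inverseT c * inverseS c ^ 2 + linForm c 3 * inverseS c ^ 3 =
    (X 0 * linForm c 0 * inverseT c - (X 0 * linForm c 1 - X 1 * linForm c 0) * inverseS c) *
      implicitQuintic c at hc
  have hq' := Dvd.intro_left _ hq.symm
  have hc' := Dvd.intro_left _ hc.symm
  clear hq hc
  generalize -inverseT c = s at *
  generalize inverseS c = t at *
  generalize implicitQuintic c = F at *
  have cross : ∀ a b : MvPolynomial (Fin 3) k,
      F ∣ b * (X 0 * s ^ 2 + X 1 * (s * t) + X 2 * t ^ 2) -
        a * (linForm c 0 * s ^ 3 + linForm c 1 * s ^ 2 * t + linForm c 2 * s * t ^ 2 +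
          linForm c 3 * t ^ 3) :=
    fun a b => dvd_sub (hq'.mul_left b) (hc'.mul_left a)
  have h01 := cross (t ^ 2) (cubicAt c 2 s t)
  have h02 := cross (s * t) (cubicAt c 1 s t)
  have h12 := cross (s ^ 2) (cubicAt c 0 s t)
  have e01 : F ∣ X 0 * minorAt c s t 1 - X 1 * minorAt c s t 0 := by
    refine (dvd_neg.2 h01).trans (dvd_of_eq ?_)
    simp only [minorAt, cubicAt, linForm, Matrix.cons_val, algebraMap_eq]
    ring
  have e02 : F ∣ X 0 * minorAt c s t 2 - X 2 * minorAt c s t 0 := by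
    refine h02.trans (dvd_of_eq ?_)
    simp only [minorAt, cubicAt, linForm, Matrix.cons_val, algebraMap_eq]
    ring
  have e12 : F ∣ X 1 * minorAt c s t 2 - X 2 * minorAt c s t 1 := by
    refine (dvd_neg.2 h12).trans (dvd_of_eq ?_)
    simp only [minorAt, cubicAt, linForm, Matrix.cons_val, algebraMap_eq]
    ring
  fin_cases i <;> fin_cases j
  · simp
  · exact e01
  · exact e02
  · simpa using dvd_neg.2 e01
  · simp
  · exact e12
  · simpa using dvd_neg.2 e02
  · simpa using dvd_neg.2 e12
  · simp

theorem implicitQuintic_dvd_pow_mul {c : Fin 4 × Fin 3 → k} {G : MvPolynomial (Fin 3) k} {n : ℕ}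
    (hG : G.IsHomogeneous n)
    (h0 : aeval (minorAt c (X 0 : MvPolynomial (Fin 2) k) (X 1)) G = 0) (j : Fin 3) :
    implicitQuintic c ∣ minorAt c (-inverseT c) (inverseS c) j ^ n * G := by
  set v := minorAt c (-inverseT c) (inverseS c) with hv
  have hvG : aeval v G = 0 := by
    have := congrArg (aeval ![-inverseT c, inverseS c]) h0
    rw [map_zero, comp_aeval_apply] at this
    convert this using 3 with i
    simp [map_minorAt, hv]
  set I := Ideal.span {implicitQuintic c} with hI
  have hπ : ∀ p, Ideal.Quotient.mkₐ k I p = 0 ↔ implicitQuintic c ∣ p := fun p => by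
    rw [Ideal.Quotient.mkₐ_eq_mk, Ideal.Quotient.eq_zero_iff_mem, hI, Ideal.mem_span_singleton]
  generalize Ideal.Quotient.mkₐ k I = π at hπ
  have hcross : ∀ i, π (v j) * π (X i) = π (X j) * π (v i) := fun i => by
    rw [← map_mul, ← map_mul, ← sub_eq_zero, ← map_sub, hπ, mul_comm (v j)]
    exact implicitQuintic_dvd_cross c i j
  have hG' : π G = aeval (fun i => π (X i)) G := by
    rw [← comp_aeval_apply, aeval_X_left_apply]
  rw [← hπ, map_mul, map_pow, hG', ← aeval_mul_of_isHomogeneous hG]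
  simp_rw [hcross]
  rw [aeval_mul_of_isHomogeneous hG, ← comp_aeval_apply, hvG, map_zero, mul_zero]

end Syzygy

section Generic

/-- The `i`-th entry of the cubic column, dehomogenized at `t = 1`. -/
noncomputable def cubicPoly {S : Type*} [CommRing S] (c : Fin 4 × Fin 3 → S) (i : Fin 3) :
    Polynomial S :=
  cubicAt (fun p => c p) i Polynomial.X 1

/-- The first quartic generating, with `quarticSnd`, the dehomogenized ideal of minors. -/
noncomputable def quarticFst {S : Type*} [CommRing S] (c : Fin 4 × Fin 3 → S) : Polynomial S :=
  Polynomial.X * cubicPoly c 2 - cubicPoly c 1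

/-- The second quartic generating the dehomogenized ideal of minors. -/
noncomputable def quarticSnd {S : Type*} [CommRing S] (c : Fin 4 × Fin 3 → S) : Polynomial S :=
  Polynomial.X * cubicPoly c 1 - cubicPoly c 0

/-- The restriction of `inverseS` to `x = 1`, `y = 0`. -/
noncomputable def quadraticS {S : Type*} [CommRing S] (c : Fin 4 × Fin 3 → S) : Polynomial S :=
  Polynomial.C (c (2, 0)) + Polynomial.C (c (2, 2) - c (0, 0)) * Polynomial.X -
    Polynomial.C (c (0, 2)) * Polynomial.X ^ 2

/-- Minus the restriction of `inverseT` to `x = 1`, `y = 0`. -/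
noncomputable def quadraticT {S : Type*} [CommRing S] (c : Fin 4 × Fin 3 → S) : Polynomial S :=
  Polynomial.C (c (1, 0) - c (3, 2)) * Polynomial.X - Polynomial.C (c (3, 0)) +
    Polynomial.C (c (1, 2)) * Polynomial.X ^ 2

variable {k : Type*} [Field k]

/-- Away from the zeros of `quarticFst` and `quarticSnd` the minors have no common zero. -/
theorem exists_minorAt_ne_zero {K : Type*} [Field K] [Algebra k K] {c : Fin 4 × Fin 3 → k}
    (hc : IsCoprime (quarticFst c) (quarticSnd c)) {s t : K} (ht : t ≠ 0) :
    ∃ j, minorAt c s t j ≠ 0 := by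
  by_contra! h
  have hcub : ∀ i, cubicAt c i s t = t ^ 3 * Polynomial.aeval (s / t) (cubicPoly c i) := by
    intro i
    simp only [cubicPoly, cubicAt, map_add, map_mul, map_pow, Polynomial.aeval_X, map_one,
      Polynomial.algebraMap_eq, Polynomial.aeval_C]
    field_simp
  have h0 := h 0
  have h2 := h 2
  simp only [minorAt, Matrix.cons_val, hcub] at h0 h2
  have e1 : Polynomial.aeval (s / t) (quarticFst c) = 0 := by
    rw [quarticFst, map_sub, map_mul, Polynomial.aeval_X]
    refine (mul_eq_zero.1 ?_).resolve_left (pow_ne_zero 5 ht)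
    rw [← h0]
    field_simp
  have e3 := h 1
  simp only [minorAt, Matrix.cons_val, hcub] at e3
  have e2 : Polynomial.aeval (s / t) (quarticSnd c) = 0 := by
    rw [quarticFst, map_sub, map_mul, Polynomial.aeval_X, sub_eq_zero] at e1
    rw [quarticSnd, map_sub, map_mul, Polynomial.aeval_X, ← e1]
    refine (mul_eq_zero.1 ?_).resolve_left (pow_ne_zero 5 ht)
    rw [← neg_eq_zero, ← e3]
    field_simp
    ring
  obtain ⟨a, b, hab⟩ := hc
  have := congrArg (Polynomial.aeval (s / t)) hab
  simp [e1, e2] at this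

theorem prime_not_dvd_minorAt {c : Fin 4 × Fin 3 → k}
    (hc : IsCoprime (quarticFst c) (quarticSnd c)) {q s t : MvPolynomial (Fin 3) k}
    (hq : Prime q) (ht : ¬ q ∣ t) : ∃ j, ¬ q ∣ minorAt c s t j := by
  set I := Ideal.span {q}
  have : I.IsPrime := (Ideal.span_singleton_prime hq.ne_zero).2 hq
  let K := FractionRing (MvPolynomial (Fin 3) k ⧸ I)
  let π : MvPolynomial (Fin 3) k →ₐ[k] K :=
    (IsScalarTower.toAlgHom k (MvPolynomial (Fin 3) k ⧸ I) K).comp (Ideal.Quotient.mkₐ k I)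
  have hπ : ∀ p, π p = 0 ↔ q ∣ p := fun p => by
    rw [← Ideal.mem_span_singleton, ← Ideal.Quotient.eq_zero_iff_mem]
    exact FaithfulSMul.algebraMap_eq_zero_iff (MvPolynomial (Fin 3) k ⧸ I) K
  obtain ⟨j, hj⟩ := exists_minorAt_ne_zero (s := π s) hc (mt (hπ t).1 ht)
  refine ⟨j, fun h => hj ?_⟩
  rwa [← map_minorAt, hπ]

theorem eval_implicitQuintic (c : Fin 4 × Fin 3 → k) :
    eval ![0, 0, 1] (implicitQuintic c) = -c (0, 2) ^ 2 := by
  simp [implicitQuintic, elimQuintic, linForm]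

/-- A homogeneous polynomial with constant restriction to the line `x = 1`, `y = 0` that does not
vanish at `(0, 0, 1)` is constant. -/
theorem isUnit_of_isHomogeneous [Infinite k] {q : MvPolynomial (Fin 3) k} {d : ℕ}
    (hq : q.IsHomogeneous d) {e : k}
    (he : aeval ![(1 : Polynomial k), 0, Polynomial.X] q = Polynomial.C e)
    (h1 : aeval ![(0 : k), 0, 1] q ≠ 0) : IsUnit q := by
  have hline : ∀ r : k, r ≠ 0 → aeval ![r, 0, 1] q = r ^ d * e := by
    intro r hr
    have hv : (fun i => Polynomial.aeval r⁻¹ (![(1 : Polynomial k), 0, Polynomial.X] i)) =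
        ![1, 0, r⁻¹] := by
      ext i
      fin_cases i <;> simp
    have hw : (fun i => r * ![1, 0, r⁻¹] i) = ![r, 0, 1] := by
      ext i
      fin_cases i <;> simp [hr]
    have h2 := congrArg (Polynomial.aeval r⁻¹) he
    rw [comp_aeval_apply, hv, Polynomial.aeval_C] at h2
    rw [← hw, aeval_mul_of_isHomogeneous hq, h2]
    rfl
  have hv : ∀ r : k, (fun i => Polynomial.aeval r (![(Polynomial.X : Polynomial k), 0, 1] i)) =
      ![r, 0, 1] := by
    intro r
    ext i
    fin_cases i <;> simp
  have hpoly : Polynomial.X * aeval ![(Polynomial.X : Polynomial k), 0, 1] q =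
      Polynomial.X * (Polynomial.X ^ d * Polynomial.C e) := by
    refine Polynomial.funext fun r => ?_
    rcases eq_or_ne r 0 with rfl | hr
    · simp
    · simp only [Polynomial.eval_mul, Polynomial.eval_X, Polynomial.eval_pow, Polynomial.eval_C]
      rw [← hline r hr, ← Polynomial.coe_aeval_eq_eval, comp_aeval_apply, hv]
  have h0 := congrArg (Polynomial.aeval (0 : k)) (mul_left_cancel₀ Polynomial.X_ne_zero hpoly)
  rw [comp_aeval_apply, hv] at h0
  have hd : d = 0 := by
    by_contra hd
    exact h1 (by simp [h0, hd])
  subst hd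
  rw [← totalDegree_zero_iff_isHomogeneous, totalDegree_eq_zero_iff_eq_C] at hq
  rw [hq] at h1 ⊢
  rw [aeval_C] at h1
  exact (isUnit_iff_ne_zero.2 h1).map C

theorem prime_not_dvd_inverseS [Infinite k] {c : Fin 4 × Fin 3 → k} (h02 : c (0, 2) ≠ 0)
    (hc : IsCoprime (quadraticS c) (quadraticT c)) {q : MvPolynomial (Fin 3) k}
    (hq : Prime q) (hF : q ∣ implicitQuintic c) : ¬ q ∣ inverseS c := by
  intro hS
  have hx : ¬ q ∣ X 0 := by
    intro h
    have hx := ((hq.dvd_prime_iff_associated X_prime).1 h).symm.dvd.trans hF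
    have := map_dvd (eval ![0, 0, 1]) hx
    rw [eval_implicitQuintic, eval_X] at this
    simp [h02] at this
  have hT : q ∣ inverseT c := by
    have h : X 0 * inverseT c ^ 2 = inverseS c * (X 1 * inverseT c - X 2 * inverseS c) +
        implicitQuintic c * -X 0 ^ 2 := by
      have := quadric_subres (X 0 : MvPolynomial (Fin 3) k) (X 1) (X 2) (linForm c 0)
        (linForm c 1) (linForm c 2) (linForm c 3)
      simp only [inverseS, inverseT, implicitQuintic]
      linear_combination this
    refine hq.dvd_of_dvd_pow (n := 2) ((hq.dvd_or_dvd ?_).resolve_left hx)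
    rw [h]
    exact dvd_add (hS.mul_right _) (hF.mul_right _)
  have hR : q ∣ linForm c 0 * X 2 ^ 2 + linForm c 3 * X 0 * X 1 - linForm c 2 * X 0 * X 2 := by
    refine (hq.dvd_or_dvd ?_).resolve_left hx
    rw [← mul_subresT_sub_mul_subresS _ _ _ _ (linForm c 1)]
    exact dvd_sub (hT.mul_left _) (hS.mul_left _)
  have hl := isHomogeneous_linForm c
  have hX := isHomogeneous_X k (σ := Fin 3)
  have hRhom : (linForm c 0 * X 2 ^ 2 + linForm c 3 * X 0 * X 1 -
      linForm c 2 * X 0 * X 2).IsHomogeneous 3 :=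
    (((hl 0).mul ((hX 2).pow 2)).add (((hl 3).mul (hX 0)).mul (hX 1))).sub
      (((hl 2).mul (hX 0)).mul (hX 2))
  have hReval : eval ![0, 0, 1] (linForm c 0 * X 2 ^ 2 + linForm c 3 * X 0 * X 1 -
      linForm c 2 * X 0 * X 2) = c (0, 2) := by
    simp [linForm]
  obtain ⟨d, hd⟩ := exists_isHomogeneous_of_dvd hRhom
    (fun h => h02 (by rw [← hReval, h, map_zero])) hR
  have hS' := map_dvd (aeval ![(1 : Polynomial k), 0, Polynomial.X]) hS
  have hT' := map_dvd (aeval ![(1 : Polynomial k), 0, Polynomial.X]) hT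
  have eS : aeval ![(1 : Polynomial k), 0, Polynomial.X] (inverseS c) = quadraticS c := by
    simp [inverseS, subresS, linForm, quadraticS, Polynomial.algebraMap_eq]
    ring
  have eT : aeval ![(1 : Polynomial k), 0, Polynomial.X] (inverseT c) = -quadraticT c := by
    simp [inverseT, subresT, linForm, quadraticT, Polynomial.algebraMap_eq]
    ring
  rw [eS] at hS'
  rw [eT, dvd_neg] at hT'
  obtain ⟨e, -, he⟩ := Polynomial.isUnit_iff.1 (hc.isUnit_of_dvd' hS' hT')
  refine hq.not_isUnit (isUnit_of_isHomogeneous hd he.symm fun h => h02 ?_)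
  have := map_dvd (eval ![0, 0, 1]) hR
  rwa [← coe_aeval_eq_eval, RingHom.coe_coe, h, ← RingHom.coe_coe, coe_aeval_eq_eval, hReval,
    zero_dvd_iff] at this

theorem ker_aeval_minorAt [Infinite k] {c : Fin 4 × Fin 3 → k} (h02 : c (0, 2) ≠ 0)
    (h4 : IsCoprime (quarticFst c) (quarticSnd c))
    (h2 : IsCoprime (quadraticS c) (quadraticT c)) :
    RingHom.ker (aeval (minorAt c (X 0 : MvPolynomial (Fin 2) k) (X 1)) :
      MvPolynomial (Fin 3) k →ₐ[k] MvPolynomial (Fin 2) k) =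
        Ideal.span {implicitQuintic c} := by
  have hF0 : implicitQuintic c ≠ 0 := fun h => by
    have := eval_implicitQuintic c
    simp [h, h02] at this
  refine le_antisymm (fun G hG => ?_) ?_
  · rw [Ideal.mem_span_singleton, ← sum_homogeneousComponent G]
    refine Finset.dvd_sum fun n _ => ?_
    refine dvd_of_forall_dvd_pow_mul hF0 (minorAt c (-inverseT c) (inverseS c)) n
      (implicitQuintic_dvd_pow_mul (homogeneousComponent_isHomogeneous n G)
        (aeval_homogeneousComponent_eq_zero (by norm_num) (isHomogeneous_minorAt c) hG n))
      fun q hq hqF => prime_not_dvd_minorAt h4 hq (prime_not_dvd_inverseS h02 h2 hq hqF)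
  · rw [Ideal.span_singleton_le_iff_mem]
    exact aeval_minorAt_implicitQuintic c

theorem isCoprime_of_resultant_ne_zero {f g : Polynomial k} {m n : ℕ} (hf : f.natDegree ≤ m)
    (hg : g.natDegree ≤ n) (hm : m ≠ 0) (h : Polynomial.resultant f g m n ≠ 0) :
    IsCoprime f g := by
  obtain ⟨a, b, -, -, hab⟩ := Polynomial.exists_mul_add_mul_eq_C_resultant f g hf hg (.inl hm)
  refine ⟨Polynomial.C (Polynomial.resultant f g m n)⁻¹ * a,
    Polynomial.C (Polynomial.resultant f g m n)⁻¹ * b, ?_⟩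
  rw [mul_assoc, mul_assoc, ← mul_add, mul_comm a, mul_comm b, hab, ← Polynomial.C_mul,
    inv_mul_cancel₀ h, Polynomial.C_1]

theorem map_cubicPoly {S T : Type*} [CommRing S] [CommRing T] (e : S →+* T)
    (c : Fin 4 × Fin 3 → S) (i : Fin 3) :
    (cubicPoly c i).map e = cubicPoly (fun p => e (c p)) i := by
  simp [cubicPoly, cubicAt, Polynomial.algebraMap_eq]

theorem natDegree_cubicPoly_le {S : Type*} [CommRing S] (c : Fin 4 × Fin 3 → S) (i : Fin 3) :
    (cubicPoly c i).natDegree ≤ 3 := by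
  simp only [cubicPoly, cubicAt, Polynomial.algebraMap_eq, one_pow, mul_one]
  compute_degree

theorem natDegree_X_mul_cubicPoly_sub_le {S : Type*} [CommRing S] (c : Fin 4 × Fin 3 → S)
    (i j : Fin 3) : (Polynomial.X * cubicPoly c i - cubicPoly c j).natDegree ≤ 4 :=
  (Polynomial.natDegree_sub_le_of_le (Polynomial.natDegree_mul_le_of_le (m := 1)
    Polynomial.natDegree_X_le (natDegree_cubicPoly_le c i)) (natDegree_cubicPoly_le c j)).trans
    (by norm_num)

/-- The polynomial in the coefficients whose nonvanishing is the genericity condition. -/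
noncomputable def genericity {S : Type*} [CommRing S] (c : Fin 4 × Fin 3 → S) : S :=
  c (0, 2) * Polynomial.resultant (quarticFst c) (quarticSnd c) 4 4 *
    Polynomial.resultant (quadraticS c) (quadraticT c) 2 2

theorem map_genericity {S T : Type*} [CommRing S] [CommRing T] (e : S →+* T)
    (c : Fin 4 × Fin 3 → S) : e (genericity c) = genericity (fun p => e (c p)) := by
  have h1 : (quarticFst c).map e = quarticFst fun p => e (c p) := by
    simp [quarticFst, map_cubicPoly]
  have h2 : (quarticSnd c).map e = quarticSnd fun p => e (c p) := by
    simp [quarticSnd, map_cubicPoly]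
  have h3 : (quadraticS c).map e = quadraticS fun p => e (c p) := by simp [quadraticS]
  have h4 : (quadraticT c).map e = quadraticT fun p => e (c p) := by simp [quadraticT]
  rw [genericity, map_mul, map_mul, ← Polynomial.resultant_map_map, ← Polynomial.resultant_map_map,
    h1, h2, h3, h4, genericity]

/-- The genericity condition holds for `A = z`, `B = C = 0`, `D = x`. -/
theorem genericity_ne_zero :
    genericity (X : Fin 4 × Fin 3 → MvPolynomial (Fin 4 × Fin 3) k) ≠ 0 := by
  intro h
  let c : Fin 4 × Fin 3 → k := fun p => if p = (0, 2) ∨ p = (3, 0) then 1 else 0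
  have h' := congrArg (eval c) h
  rw [map_genericity, map_zero] at h'
  simp only [eval_X] at h'
  have h1 : quarticFst c = Polynomial.X ^ 4 := by
    simp [quarticFst, cubicPoly, cubicAt, c]
    ring
  have h2 : quarticSnd c = Polynomial.C (-1) := by
    simp [quarticSnd, cubicPoly, cubicAt, c]
  have h3 : quadraticS c = -Polynomial.X ^ 2 := by
    simp [quadraticS, c]
  have h4 : quadraticT c = Polynomial.C (-1) := by
    simp [quadraticT, c]
  rw [genericity, h1, h2, h3, h4, Polynomial.resultant_C_right, Polynomial.resultant_C_right] at h'
  simp [c] at h'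

end Generic

set_option maxHeartbeats 1000000 in
/-- Let `k` be an infinite field, `R = k[s,t]`, and `I ⊂ R` a height-2
ideal minimally generated by three forms `f₁, f₂, f₃` of degree 5 whose Hilbert–Burch
matrix has columns of degrees 2 and 3, first column `(s², st, t²)ᵗ`, and second column
determined by generic linear forms `A, B, C, D` in `x, y, z` (genericity: the parameters
lie in the nonvanishing locus of some nonzero polynomial `p`).  Then the quintic form
`F = −x³D² + x²yCD − xy²BD + x²z(2BD − C²) + xz²(2AC − B²) + xyz(BC − 3AD) − y²zAC +
yz²AB + y³AD − z³A²` is a nonzero form of degree 5 generating the kernel of the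
`k`-algebra map `k[x,y,z] → k[f₁,f₂,f₃]`; in particular the rational map
`Ψ : P¹ ⇢ P²` defined by `f₁, f₂, f₃` is birational onto its image, a plane curve of
degree 5. -/
theorem elimination_equation_deg5_balanced_generic
    (k : Type*) [Field k] [Infinite k] :
    ∃ p : MvPolynomial (Fin 4 × Fin 3) k, p ≠ 0 ∧
      ∀ c : Fin 4 × Fin 3 → k, eval c p ≠ 0 →
        ∀ (φ : Matrix (Fin 3) (Fin 2) (MvPolynomial (Fin 2) k)),
          (φ 0 0 = X 0 ^ 2 ∧ φ 1 0 = X 0 * X 1 ∧ φ 2 0 = X 1 ^ 2) →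
          (∀ i, φ i 1 =
            C (c (0, i)) * X 0 ^ 3 + C (c (1, i)) * (X 0 ^ 2 * X 1) +
            C (c (2, i)) * (X 0 * X 1 ^ 2) + C (c (3, i)) * X 1 ^ 3) →
          ∀ f : Fin 3 → MvPolynomial (Fin 2) k,
          (∀ j, f j = (-1) ^ (j : ℕ) * (φ.submatrix j.succAbove id).det) →
          ∀ I : Ideal (MvPolynomial (Fin 2) k), I = Ideal.span (Set.range f) →
          I.heightOf = 2 →
          (¬ ∃ g₁ g₂ : MvPolynomial (Fin 2) k, I = Ideal.span {g₁, g₂}) →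
          let AL : MvPolynomial (Fin 3) k :=
            C (c (0, 0)) * X 0 + C (c (0, 1)) * X 1 + C (c (0, 2)) * X 2
          let BL : MvPolynomial (Fin 3) k :=
            C (c (1, 0)) * X 0 + C (c (1, 1)) * X 1 + C (c (1, 2)) * X 2
          let CL : MvPolynomial (Fin 3) k :=
            C (c (2, 0)) * X 0 + C (c (2, 1)) * X 1 + C (c (2, 2)) * X 2
          let DL : MvPolynomial (Fin 3) k :=
            C (c (3, 0)) * X 0 + C (c (3, 1)) * X 1 + C (c (3, 2)) * X 2
          let F : MvPolynomial (Fin 3) k :=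
            -(X 0 ^ 3 * DL ^ 2) + X 0 ^ 2 * X 1 * CL * DL - X 0 * X 1 ^ 2 * BL * DL +
              X 0 ^ 2 * X 2 * (2 * BL * DL - CL ^ 2) +
              X 0 * X 2 ^ 2 * (2 * AL * CL - BL ^ 2) +
              X 0 * X 1 * X 2 * (BL * CL - 3 * AL * DL) - X 1 ^ 2 * X 2 * AL * CL +
              X 1 * X 2 ^ 2 * AL * BL + X 1 ^ 3 * AL * DL - X 2 ^ 3 * AL ^ 2
          F ≠ 0 ∧ F.IsHomogeneous 5 ∧
            RingHom.ker
                (MvPolynomial.aeval f :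
                  MvPolynomial (Fin 3) k →ₐ[k] MvPolynomial (Fin 2) k) =
              Ideal.span {F} := by
  refine ⟨genericity X, genericity_ne_zero, ?_⟩
  intro c hc φ ⟨h0, h1, h2⟩ h f hf I _ _ _ AL BL CL DL F
  rw [map_genericity] at hc
  simp only [eval_X] at hc
  have h02 : c (0, 2) ≠ 0 := left_ne_zero_of_mul (left_ne_zero_of_mul hc)
  have h4 : IsCoprime (quarticFst c) (quarticSnd c) :=
    isCoprime_of_resultant_ne_zero (natDegree_X_mul_cubicPoly_sub_le c 2 1)
      (natDegree_X_mul_cubicPoly_sub_le c 1 0) (by norm_num)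
      (right_ne_zero_of_mul (left_ne_zero_of_mul hc))
  have h2' : IsCoprime (quadraticS c) (quadraticT c) := by
    refine isCoprime_of_resultant_ne_zero ?_ ?_ (by norm_num) (right_ne_zero_of_mul hc)
    · rw [quadraticS]
      compute_degree
    · rw [quadraticT]
      compute_degree
  have hF : F = implicitQuintic c := rfl
  have hfc : f = minorAt c (X 0) (X 1) := by
    funext j
    rw [hf]
    fin_cases j <;>
      simp [Matrix.det_fin_two, Fin.succAbove, minorAt, cubicAt, h0, h1, h2, h, algebraMap_eq] <;>
      ring
  rw [hF, hfc]
  refine ⟨fun h => ?_, isHomogeneous_implicitQuintic c, ker_aeval_minorAt h02 h4 h2'⟩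
  have := eval_implicitQuintic c
  simp [h, h02] at this
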